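/- arXiv:2309.08509 — 3 statements merged into one kernel-verified Lean document; each statement's English description precedes it below -/
import Mathlib

section
/- Let Γ be a finite connected multigraph equipped with a genus function g : Verts(Γ) → ℕ, and let g(Γ) := b₁(Γ) + Σ_v g(v). Then the assignment σ_IBD, consisting of all pairs (G, 𝐝) with G a connected spanning subgraph of Γ and 𝐝 an integral break divisor for G, is a degree-g(Γ) stability assignment for Γ. -/
open Finset

variable {V E : Type} [Fintype V] [Fintype E] [DecidableEq V] [DecidableEq E]

/-- The unordered pair of endpoints of an edge. -/
def eSym (ends : E → V × V) (e : E) : Sym2 V := s((ends e).1, (ends e).2)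

/-- Reachability in the spanning subgraph with edge set `A`. -/
def Linked (ends : E → V × V) (A : Finset E) : V → V → Prop :=
  Relation.ReflTransGen (fun v w => ∃ e ∈ A, eSym ends e = s(v, w))

/-- The spanning subgraph with edge set `A` is connected. -/
def Conn (ends : E → V × V) (A : Finset E) : Prop :=
  Nonempty V ∧ ∀ v w : V, Linked ends A v w

/-- The induced subgraph on the vertex set `W` is connected. -/
def ConnOn (ends : E → V × V) (W : Finset V) : Prop :=
  W.Nonempty ∧ ∀ v ∈ W, ∀ w ∈ W,
    Relation.ReflTransGen (fun a b => a ∈ W ∧ b ∈ W ∧ ∃ e : E, eSym ends e = s(a, b)) v w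

/-- A spanning tree: a connected spanning subgraph with `|V| - 1` edges. -/
def IsSpanningTree (ends : E → V × V) (A : Finset E) : Prop :=
  Conn ends A ∧ A.card + 1 = Fintype.card V

/-- The complexity of the spanning subgraph `A`: the number of its spanning trees. -/
noncomputable def complexity (ends : E → V × V) (A : Finset E) : ℕ :=
  Nat.card {T : Finset E // T ⊆ A ∧ IsSpanningTree ends T}

/-- `n(G)`: the number of edges of `Γ` missing from the spanning subgraph `G`. -/
def nG (A : Finset E) : ℕ := (Finset.univ \ A).card

/-- The space of multidegrees of total degree `d` at `A`. -/
def Sdeg (d : ℤ) (A : Finset E) : Set (V → ℤ) :=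
  {x | ∑ v, x v = d - (nG A : ℤ)}

/-- The twister at vertex `v` of the spanning subgraph with edge set `A`. -/
def twVec (ends : E → V × V) (A : Finset E) (v : V) : V → ℤ := fun w =>
  if w = v then
    -((A.filter (fun e => v ∈ eSym ends e ∧ ¬(eSym ends e).IsDiag)).card : ℤ)
  else ((A.filter (fun e => eSym ends e = s(v, w))).card : ℤ)

/-- The twister (chip-firing) group of the spanning subgraph with edge set `A`. -/
def twGroup (ends : E → V × V) (A : Finset E) : AddSubgroup (V → ℤ) :=
  AddSubgroup.closure (Set.range (twVec ends A))

/-- The standard basis vector at `v`. -/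
def stdVec (v : V) : V → ℤ := fun w => if w = v then 1 else 0

/-- A degree-`d` assignment: supported on connected spanning subgraphs, with the
prescribed total degree. -/
def IsAssignment (ends : E → V × V) (d : ℤ) (σ : Finset E → Set (V → ℤ)) : Prop :=
  ∀ A : Finset E, ∀ x ∈ σ A, Conn ends A ∧ x ∈ Sdeg d A

/-- Condition (1), chip-adding. -/
def ChipAdding (ends : E → V × V) (σ : Finset E → Set (V → ℤ)) : Prop :=
  ∀ A : Finset E, ∀ x ∈ σ A, ∀ e ∉ A, ∀ v ∈ eSym ends e, x + stdVec v ∈ σ (insert e A)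

/-- `S` is a minimal complete set of representatives for the action of the twister group
of `A` on the multidegree space `S^d(A)`. -/
def IsRepSet (ends : E → V × V) (d : ℤ) (A : Finset E) (S : Set (V → ℤ)) : Prop :=
  S ⊆ Sdeg d A ∧ ∀ x ∈ Sdeg (E := E) d A, ∃! y, y ∈ S ∧ x - y ∈ twGroup ends A

/-- A degree-`d` stability assignment. -/
def IsStabilityAssignment (ends : E → V × V) (d : ℤ) (σ : Finset E → Set (V → ℤ)) : Prop :=
  IsAssignment ends d σ ∧ ChipAdding ends σ ∧
    ∀ A : Finset E, Conn ends A → IsRepSet ends d A (σ A)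

/-- Vertices of the subdivision `Γ̃_m`: original vertices plus, for each edge `e`,
`m e` exceptional vertices. -/
abbrev SubV (V E : Type) (m : E → ℕ) : Type := V ⊕ (Σ e : E, Fin (m e))

/-- Edges of the subdivision `Γ̃_m`: each edge `e` is replaced by a chain of `m e + 1` edges. -/
abbrev SubE (E : Type) (m : E → ℕ) : Type := Σ e : E, Fin (m e + 1)

/-- The `i`-th vertex along the chain replacing the edge `e` in the subdivision. -/
def subNode (ends : E → V × V) (m : E → ℕ) (e : E) (i : ℕ) : SubV V E m :=
  if h0 : i = 0 then Sum.inl (ends e).1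
  else if h : i ≤ m e then Sum.inr ⟨e, ⟨i - 1, by omega⟩⟩
  else Sum.inl (ends e).2

/-- The endpoints of the edges of the subdivision `Γ̃_m`. -/
def subEnds (ends : E → V × V) (m : E → ℕ) : SubE E m → SubV V E m × SubV V E m :=
  fun p => (subNode ends m p.1 p.2.val, subNode ends m p.1 (p.2.val + 1))

/-- The lift of the multidegree `x` on `(A, Γ)`: extend by zero and add one chip on
the exceptional vertex `t e` of every removed edge `e ∉ A`. -/
def liftOf (m : E → ℕ) (A : Finset E) (x : V → ℤ) (t : E → ℕ) : SubV V E m → ℤ :=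
  Sum.elim x fun p => if p.1 ∉ A ∧ (p.2 : ℕ) = t p.1 then 1 else 0

/-- The lift `σ̃_m` of an assignment `σ`: all lifts of all elements of `σ`. -/
def liftSet (m : E → ℕ) (σ : Finset E → Set (V → ℤ)) : Set (SubV V E m → ℤ) :=
  {y | ∃ (A : Finset E) (x : V → ℤ) (t : E → ℕ),
    x ∈ σ A ∧ (∀ e ∉ A, t e < m e) ∧ y = liftOf m A x t}

/-- Edges with both endpoints in `W` (the edges of the induced subgraph `Γ(W)`). -/
def inE (ends : E → V × V) (W : Finset V) : Finset E :=
  Finset.univ.filter fun e => (ends e).1 ∈ W ∧ (ends e).2 ∈ W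

/-- Edges with one endpoint in `W` and the other in `Wᶜ`. -/
def cutE (ends : E → V × V) (W : Finset V) : Finset E :=
  Finset.univ.filter fun e =>
    ((ends e).1 ∈ W ∧ (ends e).2 ∉ W) ∨ ((ends e).1 ∉ W ∧ (ends e).2 ∈ W)

/-- `φ`-semistability of the multidegree `x` on the spanning subgraph `A`. -/
def PhiSemistable (ends : E → V × V) (φ : V → ℝ) (A : Finset E) (x : V → ℤ) : Prop :=
  ∀ W : Finset V, W.Nonempty → W ≠ Finset.univ →
    |(∑ v ∈ W, ((x v : ℝ) - φ v)) + (((Finset.univ \ A) ∩ inE ends W).card : ℝ) +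
        (((Finset.univ \ A) ∩ cutE ends W).card : ℝ) / 2| ≤
      ((A ∩ cutE ends W).card : ℝ) / 2

/-- `φ`-stability of the multidegree `x` on the spanning subgraph `A`. -/
def PhiStable (ends : E → V × V) (φ : V → ℝ) (A : Finset E) (x : V → ℤ) : Prop :=
  ∀ W : Finset V, W.Nonempty → W ≠ Finset.univ →
    |(∑ v ∈ W, ((x v : ℝ) - φ v)) + (((Finset.univ \ A) ∩ inE ends W).card : ℝ) +
        (((Finset.univ \ A) ∩ cutE ends W).card : ℝ) / 2| <
      ((A ∩ cutE ends W).card : ℝ) / 2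

/-- Nondegeneracy of a numerical polarization `φ`. -/
def Nondegenerate (ends : E → V × V) (d : ℤ) (φ : V → ℝ) : Prop :=
  ∀ A : Finset E, ∀ x ∈ Sdeg d A, PhiSemistable ends φ A x → PhiStable ends φ A x

/-- The assignment `stab_{Γ,φ}` associated with a numerical polarization `φ`. -/
def stabAssign (ends : E → V × V) (d : ℤ) (φ : V → ℝ) : Finset E → Set (V → ℤ) :=
  fun A => {x | Conn ends A ∧ x ∈ Sdeg d A ∧ PhiSemistable ends φ A x}

/-- The valence of the vertex `v` (loops counted twice). -/
def valence (ends : E → V × V) (v : V) : ℕ :=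
  ∑ e : E, ((if (ends e).1 = v then 1 else 0) + (if (ends e).2 = v then 1 else 0))

/-- `x` is an integral break divisor for the connected spanning subgraph `A`. -/
def isIBD (ends : E → V × V) (gen : V → ℕ) (A : Finset E) (x : V → ℤ) : Prop :=
  ∃ T : Finset E, T ⊆ A ∧ IsSpanningTree ends T ∧
    ∃ t : E → V, (∀ e ∈ A \ T, t e ∈ eSym ends e) ∧
      x = fun v => (gen v : ℤ) + (((A \ T).filter fun e => t e = v).card : ℤ)

/-- The multidegree `(a, b)` on a two-vertex graph with first vertex `v₁`. -/
def pairFn (v₁ : V) (a b : ℤ) : V → ℤ := fun w => if w = v₁ then a else b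

/-- The edges of `A` with both endpoints in `W`. -/
def innerEdges (ends : E → V × V) (A : Finset E) (W : Finset V) : Finset E :=
  A.filter fun e => (ends e).1 ∈ W ∧ (ends e).2 ∈ W

omit [Fintype V] [Fintype E] [DecidableEq V] [DecidableEq E] in
lemma mem_eSym {ends : E → V × V} {e : E} {v : V} :
    v ∈ eSym ends e ↔ v = (ends e).1 ∨ v = (ends e).2 := by
  simp [eSym]

omit [Fintype V] [Fintype E] [DecidableEq V] [DecidableEq E] in
lemma Linked.mono {ends : E → V × V} {A B : Finset E} (h : A ⊆ B) {v w : V}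
    (hl : Linked ends A v w) : Linked ends B v w := by
  induction hl with
  | refl => exact Relation.ReflTransGen.refl
  | tail _ hbc ih =>
    obtain ⟨e, he, h'⟩ := hbc
    exact ih.tail ⟨e, h he, h'⟩

omit [Fintype V] [Fintype E] [DecidableEq V] [DecidableEq E] in
lemma Linked.symm {ends : E → V × V} {A : Finset E} {v w : V}
    (hl : Linked ends A v w) : Linked ends A w v := by
  induction hl with
  | refl => exact Relation.ReflTransGen.refl
  | tail _ hbc ih =>
    obtain ⟨e, he, h⟩ := hbc
    exact ih.head ⟨e, he, h.trans Sym2.eq_swap⟩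

omit [Fintype V] [Fintype E] [DecidableEq V] [DecidableEq E] in
lemma Linked.exists_crossing {ends : E → V × V} {A : Finset E} {W : Finset V} {v w : V}
    (hl : Linked ends A v w) (hv : v ∈ W) (hw : w ∉ W) :
    ∃ a ∈ W, ∃ b ∉ W, ∃ e ∈ A, eSym ends e = s(a, b) := by
  induction hl with
  | refl => exact absurd hv hw
  | @tail b c _ hbc ih =>
    by_cases hb : b ∈ W
    · exact ⟨b, hb, c, hw, hbc⟩
    · exact ih hb

omit [Fintype E] [DecidableEq E] in
/-- In a connected graph at least `|V| - |W|` edges are not inside `W`. -/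
lemma card_innerEdges_add_le {ends : E → V × V} {A : Finset E} (hA : Conn ends A) :
    ∀ (k : ℕ) (W : Finset V), W.Nonempty → W.card + k = Fintype.card V →
      (innerEdges ends A W).card + k ≤ A.card := by
  intro k
  induction k with
  | zero => intro W _ _; exact Finset.card_filter_le _ _
  | succ k ih =>
    intro W hW hk
    obtain ⟨v, hv⟩ := hW
    obtain ⟨w, hw⟩ : ∃ w, w ∉ W := by
      by_contra! h
      have : W = Finset.univ := Finset.eq_univ_iff_forall.2 h
      rw [this, Finset.card_univ] at hk
      omega
    obtain ⟨a, ha, b, hb, e, he, hab⟩ := (hA.2 v w).exists_crossing hv hw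
    have hlt : (innerEdges ends A W).card < (innerEdges ends A (insert b W)).card := by
      apply Finset.card_lt_card
      rw [Finset.ssubset_iff_of_subset]
      · refine ⟨e, ?_, ?_⟩ <;>
        · simp only [eSym, Sym2.eq_iff] at hab
          rcases hab with ⟨h1, h2⟩ | ⟨h1, h2⟩ <;> simp [innerEdges, he, h1, h2, ha, hb]
      · intro e'
        simp only [innerEdges, Finset.mem_filter, Finset.mem_insert]
        tauto
    have := ih (insert b W) (Finset.insert_nonempty _ _)
      (by rw [Finset.card_insert_of_notMem hb]; omega)
    omega

omit [Fintype E] in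
/-- A graph all of whose vertices can be reached from `q` along an orientation `t` has a
spanning tree oriented away from `q`. -/
lemma exists_arborescence {ends : E → V × V} {A : Finset E} {t : E → V} (q : V)
    (hreach : ∀ R : Finset V, q ∈ R → R ≠ Finset.univ →
      ∃ e ∈ A, t e ∉ R ∧ ∃ a ∈ R, eSym ends e = s(a, t e)) :
    ∃ T ⊆ A, IsSpanningTree ends T ∧
      ∀ v, (T.filter fun e => t e = v).card = if v = q then 0 else 1 := by
  have grow : ∀ k : ℕ, k + 1 ≤ Fintype.card V → ∃ (R : Finset V) (T : Finset E),
      q ∈ R ∧ R.card = k + 1 ∧ T ⊆ A ∧ T.card = k ∧ (∀ v ∈ R, Linked ends T q v) ∧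
      ∀ v, (T.filter fun e => t e = v).card = if v ∈ R ∧ v ≠ q then 1 else 0 := by
    intro k
    induction k with
    | zero =>
      intro _
      refine ⟨{q}, ∅, by simp, by simp, by simp, by simp, ?_, ?_⟩
      · intro v hv
        rw [Finset.mem_singleton.1 hv]
        exact Relation.ReflTransGen.refl
      · intro v
        simp
    | succ k ih =>
      intro hk
      obtain ⟨R, T, hq, hR, hTA, hT, hl, hc⟩ := ih (by omega)
      obtain ⟨e, he, hte, a, ha, hea⟩ := hreach R hq (by
        rintro rfl
        rw [Finset.card_univ] at hR
        omega)
      have heT : e ∉ T := by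
        intro h
        have h0 := hc (t e)
        rw [if_neg (by tauto), Finset.card_eq_zero] at h0
        exact Finset.notMem_empty e (h0 ▸ Finset.mem_filter.2 ⟨h, rfl⟩)
      refine ⟨insert (t e) R, insert e T, by simp [hq], ?_, ?_, ?_, ?_, ?_⟩
      · rw [Finset.card_insert_of_notMem hte, hR]
      · exact Finset.insert_subset he hTA
      · rw [Finset.card_insert_of_notMem heT, hT]
      · have hmono : T ⊆ insert e T := Finset.subset_insert _ _
        intro v hv
        rcases Finset.mem_insert.1 hv with rfl | hv
        · exact ((hl a ha).mono hmono).tail ⟨e, Finset.mem_insert_self _ _, hea⟩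
        · exact (hl v hv).mono hmono
      · intro v
        rw [Finset.filter_insert]
        by_cases hv : t e = v
        · have hvq : v ≠ q := by rintro rfl; exact hte (hv ▸ hq)
          have := hc v
          rw [if_neg (by rw [← hv]; tauto)] at this
          rw [if_pos hv, Finset.card_insert_of_notMem (by simp [heT]), this,
            if_pos ⟨by simp [hv], hvq⟩]
        · rw [if_neg hv, hc v]
          simp [Ne.symm hv]
  have hpos : 0 < Fintype.card V := Fintype.card_pos_iff.2 ⟨q⟩
  obtain ⟨R, T, hq, hR, hTA, hT, hl, hc⟩ := grow (Fintype.card V - 1) (by omega)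
  have hRu : R = Finset.univ := by
    rw [← Finset.card_eq_iff_eq_univ]
    omega
  subst hRu
  refine ⟨T, hTA, ⟨⟨⟨q⟩, fun v w => ?_⟩, by omega⟩, fun v => ?_⟩
  · exact (hl v (Finset.mem_univ _)).symm.trans (hl w (Finset.mem_univ _))
  · rw [hc v]
    by_cases h : v = q <;> simp [h]

omit [Fintype E] in
/-- Hakimi's theorem: a vector with the right total and with at least as many chips on every
vertex set as there are edges inside is the vector of indegrees of an orientation. -/
lemma exists_orientation (ends : E → V × V) (A : Finset E) (D : V → ℕ)
    (htot : ∑ v, D v = A.card)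
    (hD : ∀ W : Finset V, W.Nonempty → (innerEdges ends A W).card ≤ ∑ v ∈ W, D v) :
    ∃ t : E → V, (∀ e ∈ A, t e ∈ eSym ends e) ∧
      ∀ v, (A.filter fun e => t e = v).card = D v := by
  classical
  let slots : A → Finset (Σ v : V, Fin (D v)) := fun e =>
    (Finset.univ.filter fun v => v ∈ eSym ends e.1).sigma fun _ => Finset.univ
  have hall : ∀ S : Finset A, S.card ≤ (S.biUnion slots).card := by
    intro S
    let W : Finset V := Finset.univ.filter fun v => ∃ e ∈ S, v ∈ eSym ends e.1
    have h1 : W.sigma (fun v => (Finset.univ : Finset (Fin (D v)))) ⊆ S.biUnion slots := by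
      rintro ⟨v, i⟩ h
      simpa [W, slots] using h
    have h2 : S.card ≤ (innerEdges ends A W).card := by
      rw [← Finset.card_map (Function.Embedding.subtype _)]
      apply Finset.card_le_card
      intro e he
      obtain ⟨e, heS, rfl⟩ := Finset.mem_map.1 he
      simp only [innerEdges, Finset.mem_filter, W, Finset.mem_univ, true_and]
      exact ⟨e.2, ⟨e, heS, mem_eSym.2 (Or.inl rfl)⟩, ⟨e, heS, mem_eSym.2 (Or.inr rfl)⟩⟩
    have h3 := Finset.card_le_card h1
    rw [Finset.card_sigma] at h3
    simp only [Finset.card_univ, Fintype.card_fin] at h3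
    rcases W.eq_empty_or_nonempty with hW | hW
    · rw [hW] at h2
      simp only [innerEdges, Finset.notMem_empty, false_and, Finset.filter_false,
        Finset.card_empty] at h2
      omega
    · have := hD W hW
      omega
  obtain ⟨F, hinj, hF⟩ := (Finset.all_card_le_biUnion_card_iff_exists_injective slots).1 hall
  let t : E → V := fun e => if h : e ∈ A then (F ⟨e, h⟩).1 else (ends e).1
  have hle : ∀ v ∈ Finset.univ, (A.filter fun e => t e = v).card ≤ D v := by
    intro v _
    have h : (A.filter fun e => t e = v).card ≤
        (({v} : Finset V).sigma fun v => (Finset.univ : Finset (Fin (D v)))).card := by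
      rw [← Finset.card_attach]
      refine Finset.card_le_card_of_injOn
        (fun e => F ⟨e.1, (Finset.mem_filter.1 e.2).1⟩) ?_ ?_
      · rintro ⟨e, he⟩ _
        have he' := Finset.mem_filter.1 he
        simpa [t, he'.1] using he'.2
      · intro e _ e' _ h
        have := hinj h
        simp only [Subtype.mk.injEq] at this
        exact Subtype.ext this
    rw [Finset.card_sigma] at h
    simpa using h
  have hsum : ∑ v, (A.filter fun e => t e = v).card = ∑ v, D v := by
    rw [htot, ← Finset.card_eq_sum_card_fiberwise (fun _ _ => Finset.mem_coe.2 (Finset.mem_univ _))]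
  refine ⟨t, fun e he => ?_, fun v => (Finset.sum_eq_sum_iff_of_le hle).1 hsum v
    (Finset.mem_univ v)⟩
  have := hF ⟨e, he⟩
  simp only [slots, Finset.mem_sigma, Finset.mem_filter, Finset.mem_univ, true_and,
    and_true] at this
  simpa [t, he] using this

/-- The inequalities cutting out the break divisors (of genus zero vertices) of the spanning
subgraph with edge set `A`. -/
def IsBalanced (ends : E → V × V) (A : Finset E) (y : V → ℤ) : Prop :=
  ∑ v, y v = A.card - Fintype.card V + 1 ∧
    ∀ W : Finset V, W.Nonempty → ((innerEdges ends A W).card : ℤ) - W.card + 1 ≤ ∑ v ∈ W, y v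

omit [Fintype E] in
lemma isBalanced_of_spanningTree {ends : E → V × V} {A T : Finset E} {t : E → V} (hTA : T ⊆ A)
    (hT : IsSpanningTree ends T) (ht : ∀ e ∈ A \ T, t e ∈ eSym ends e) :
    IsBalanced ends A fun v => (((A \ T).filter fun e => t e = v).card : ℤ) := by
  have hcard := Finset.card_sdiff_add_card_eq_card hTA
  have hsum : ∀ W : Finset V, ∑ v ∈ W, ((A \ T).filter fun e => t e = v).card =
      ((A \ T).filter fun e => t e ∈ W).card := by
    intro W
    rw [Finset.card_eq_sum_card_fiberwise (f := t) (t := W) (fun e he => by simp_all)]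
    refine Finset.sum_congr rfl fun v hv => ?_
    rw [Finset.filter_filter]
    congr 1
    ext e
    simp only [Finset.mem_filter]
    grind
  refine ⟨?_, fun W hW => ?_⟩
  · have := hsum Finset.univ
    simp only [Finset.mem_univ, Finset.filter_true] at this
    have h2 := hT.2
    push_cast [← Nat.cast_sum, this]
    omega
  · have h1 := hsum W
    have h2 : (innerEdges ends A W).card ≤
        ((A \ T).filter fun e => t e ∈ W).card + (innerEdges ends T W).card := by
      refine le_trans (Finset.card_le_card ?_) (Finset.card_union_le _ _)
      intro e
      have := ht e
      simp only [mem_eSym, innerEdges, Finset.mem_filter, Finset.mem_union,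
        Finset.mem_sdiff] at this ⊢
      grind
    have hWV := Finset.card_le_univ W
    have h3 := card_innerEdges_add_le hT.1 (Fintype.card V - W.card) W hW (by omega)
    have h4 := hT.2
    rw [← Nat.cast_sum, h1]
    omega

omit [Fintype E] in
lemma IsBalanced.exists_spanningTree {ends : E → V × V} {A : Finset E} {y : V → ℤ} [Nonempty V]
    (hy : IsBalanced ends A y) :
    ∃ T ⊆ A, IsSpanningTree ends T ∧ ∃ t : E → V, (∀ e ∈ A \ T, t e ∈ eSym ends e) ∧
      y = fun v => (((A \ T).filter fun e => t e = v).card : ℤ) := by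
  obtain ⟨q⟩ := ‹Nonempty V›
  have hsum : ∀ W : Finset V, ∑ v ∈ W, (y v + 1 - if v = q then 1 else 0) =
      ∑ v ∈ W, y v + W.card - if q ∈ W then 1 else 0 := by
    intro W
    simp [Finset.sum_add_distrib, Finset.sum_sub_distrib]
  have hnonneg : ∀ v, 0 ≤ y v + 1 - if v = q then 1 else 0 := by
    intro v
    have := hy.2 {v} (Finset.singleton_nonempty v)
    simp only [Finset.card_singleton, Finset.sum_singleton] at this
    split_ifs <;> omega
  lift (fun v => y v + 1 - if v = q then 1 else 0 : V → ℤ) to V → ℕ using hnonneg with D hD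
  have hD' : ∀ v, (D v : ℤ) = y v + 1 - if v = q then 1 else 0 := fun v => congrFun hD v
  have hDsum : ∀ W : Finset V, ((∑ v ∈ W, D v : ℕ) : ℤ) =
      ∑ v ∈ W, y v + W.card - if q ∈ W then 1 else 0 := by
    intro W
    rw [← hsum, Nat.cast_sum]
  obtain ⟨t, ht, htD⟩ := exists_orientation ends A D
    (by
      have := hDsum Finset.univ
      rw [hy.1, if_pos (Finset.mem_univ q), Finset.card_univ] at this
      omega)
    (by
      intro W hW
      have h1 := hDsum W
      have h2 := hy.2 W hW
      split_ifs at h1 <;> omega)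
  obtain ⟨T, hTA, hT, hTc⟩ := exists_arborescence (ends := ends) (A := A) (t := t) q (by
    intro R hq hR
    by_contra! hcon
    have hne : Rᶜ.Nonempty := by
      rwa [Finset.nonempty_iff_ne_empty, Ne, Finset.compl_eq_empty_iff]
    have h1 := hDsum Rᶜ
    rw [if_neg (by simpa using hq)] at h1
    have h2 := hy.2 Rᶜ hne
    have h3 : ∑ v ∈ Rᶜ, D v ≤ (innerEdges ends A Rᶜ).card := by
      rw [Finset.sum_congr rfl fun v _ => (htD v).symm,
        ← Finset.card_biUnion fun v _ w _ hvw => Finset.disjoint_filter.2 fun e _ h h' =>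
          hvw (h.symm.trans h')]
      refine Finset.card_le_card fun e he => ?_
      simp only [Finset.mem_biUnion, Finset.mem_filter, Finset.mem_compl] at he
      obtain ⟨v, hv, heA, rfl⟩ := he
      have h4 := mem_eSym.1 (ht e heA)
      simp only [innerEdges, Finset.mem_filter, Finset.mem_compl, heA, true_and]
      rcases h4 with h4 | h4
      · refine ⟨h4 ▸ hv, fun h => hcon e heA hv _ h ?_⟩
        rw [h4, eSym, Sym2.eq_swap]
      · refine ⟨fun h => hcon e heA hv _ h ?_, h4 ▸ hv⟩
        rw [h4, eSym]
    omega)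
  refine ⟨T, hTA, hT, t, fun e he => ht e (Finset.mem_sdiff.1 he).1, funext fun v => ?_⟩
  have h1 : ((A \ T).filter fun e => t e = v).card + (T.filter fun e => t e = v).card =
      (A.filter fun e => t e = v).card := by
    rw [← Finset.card_union_of_disjoint
      (Finset.disjoint_filter_filter Finset.sdiff_disjoint), ← Finset.filter_union,
      Finset.sdiff_union_of_subset hTA]
  have h2 := hD' v
  rw [htD v, hTc v] at h1
  split_ifs at h1 h2 <;> omega

omit [Fintype E] in
lemma isIBD_iff {ends : E → V × V} {gen : V → ℕ} {A : Finset E} [Nonempty V] {x : V → ℤ} :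
    isIBD ends gen A x ↔ IsBalanced ends A fun v => x v - gen v := by
  constructor
  · rintro ⟨T, hTA, hT, t, ht, rfl⟩
    simpa using isBalanced_of_spanningTree hTA hT ht
  · intro h
    obtain ⟨T, hTA, hT, t, ht, hx⟩ := h.exists_spanningTree
    refine ⟨T, hTA, hT, t, ht, funext fun v => ?_⟩
    rw [← congrFun hx v]
    ring

/-- The graph Laplacian (with negative diagonal) of the spanning subgraph with edge set `A`. -/
def laplacian (ends : E → V × V) (A : Finset E) : (V → ℤ) →ₗ[ℤ] (V → ℤ) where
  toFun f w := ∑ e ∈ A, ((if w = (ends e).1 then 1 else 0) - if w = (ends e).2 then 1 else 0) *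
    (f (ends e).2 - f (ends e).1)
  map_add' f g := by
    ext w
    simp only [Pi.add_apply, ← Finset.sum_add_distrib]
    exact Finset.sum_congr rfl fun _ _ => by ring
  map_smul' c f := by
    ext w
    simp only [Pi.smul_apply, smul_eq_mul, RingHom.id_apply, Finset.mul_sum]
    exact Finset.sum_congr rfl fun _ _ => by ring

omit [Fintype V] [Fintype E] [DecidableEq E] in
lemma laplacian_single (ends : E → V × V) (A : Finset E) (v : V) :
    laplacian ends A (Pi.single v 1) = twVec ends A v := by
  ext w
  simp only [laplacian, LinearMap.coe_mk, AddHom.coe_mk, twVec, Finset.card_filter,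
    Nat.cast_sum, ← Finset.sum_neg_distrib]
  split_ifs with h
  · subst h
    refine Finset.sum_congr rfl fun e _ => ?_
    simp only [eSym, Sym2.mk_isDiag_iff, Pi.single_apply]
    grind
  · refine Finset.sum_congr rfl fun e _ => ?_
    simp only [eSym, Sym2.eq_iff, Pi.single_apply]
    grind

omit [Fintype E] [DecidableEq E] in
lemma mem_twGroup_iff {ends : E → V × V} {A : Finset E} {z : V → ℤ} :
    z ∈ twGroup ends A ↔ ∃ f, laplacian ends A f = z := by
  constructor
  · intro hz
    have hle : twGroup ends A ≤ (LinearMap.range (laplacian ends A)).toAddSubgroup := by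
      refine (AddSubgroup.closure_le _).2 ?_
      rintro _ ⟨v, rfl⟩
      exact ⟨_, laplacian_single ends A v⟩
    exact hle hz
  · rintro ⟨f, rfl⟩
    rw [pi_eq_sum_univ' f, map_sum]
    refine sum_mem fun v _ => ?_
    rw [map_smul]
    refine zsmul_mem (K := twGroup ends A) (AddSubgroup.subset_closure ?_) _
    refine ⟨v, (laplacian_single ends A v).symm.trans ?_⟩
    congr 1

omit [Fintype V] [Fintype E] [DecidableEq E] in
lemma sum_laplacian (ends : E → V × V) (A : Finset E) (f : V → ℤ) (W : Finset V) :
    ∑ w ∈ W, laplacian ends A f w = ∑ e ∈ A,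
      ((if (ends e).1 ∈ W then 1 else 0) - if (ends e).2 ∈ W then 1 else 0) *
        (f (ends e).2 - f (ends e).1) := by
  simp only [laplacian, LinearMap.coe_mk, AddHom.coe_mk]
  rw [Finset.sum_comm]
  refine Finset.sum_congr rfl fun e _ => ?_
  rw [← Finset.sum_mul, Finset.sum_sub_distrib]
  simp

omit [Fintype E] [DecidableEq E] in
lemma IsBalanced.eq_of_sub_mem {ends : E → V × V} {A : Finset E} {x y : V → ℤ}
    (hx : IsBalanced ends A x) (hy : IsBalanced ends A y) (h : x - y ∈ twGroup ends A) :
    x = y := by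
  obtain ⟨f, hf⟩ := mem_twGroup_iff.1 h
  rcases isEmpty_or_nonempty V with hV | hV
  · exact Subsingleton.elim _ _
  obtain ⟨m, hm⟩ := Finite.exists_max f
  let W : Finset V := Finset.univ.filter fun v => f v = f m
  have hWmem : ∀ v, v ∈ W ↔ f v = f m := fun v => by simp [W]
  by_cases hW : W = Finset.univ
  · have hconst : ∀ v, f v = f m := fun v => (hWmem v).1 (hW ▸ Finset.mem_univ v)
    rw [← sub_eq_zero, ← hf]
    ext w
    simp [laplacian, hconst]
  · exfalso
    have hWc : Wᶜ.Nonempty := by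
      rwa [Finset.nonempty_iff_ne_empty, Ne, Finset.compl_eq_empty_iff]
    have h1 := hx.2 W ⟨m, (hWmem m).2 rfl⟩
    have h2 := hy.2 Wᶜ hWc
    have h3 : ∑ v ∈ W, y v + ∑ v ∈ Wᶜ, y v = ∑ v, y v := Finset.sum_add_sum_compl W y
    rw [hy.1] at h3
    have h4 := sum_laplacian ends A f W
    rw [hf] at h4
    simp only [Pi.sub_apply, Finset.sum_sub_distrib] at h4
    have h5 : ∑ e ∈ A, (((if (ends e).1 ∈ W then 1 else 0) - if (ends e).2 ∈ W then 1 else 0) *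
        (f (ends e).2 - f (ends e).1)) ≤
        (innerEdges ends A W).card + (innerEdges ends A Wᶜ).card - (A.card : ℤ) := by
      simp only [innerEdges, Finset.card_filter, Finset.card_eq_sum_ones A, Nat.cast_sum,
        ← Finset.sum_add_distrib, ← Finset.sum_sub_distrib]
      refine Finset.sum_le_sum fun e _ => ?_
      have ha := hm (ends e).1
      have hb := hm (ends e).2
      simp only [Finset.mem_compl, hWmem]
      by_cases h6 : f (ends e).1 = f m <;> by_cases h7 : f (ends e).2 = f m <;>
        simp [h6, h7] <;> omega
    have h6 : W.card + Wᶜ.card = Fintype.card V := Finset.card_add_card_compl W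
    omega

omit [Fintype V] [Fintype E] [DecidableEq V] [DecidableEq E] in
/-- The oscillation of a function along a path is bounded by its total variation. -/
lemma Linked.exists_abs_sub_le {ends : E → V × V} {A : Finset E} {v w : V}
    (h : Linked ends A v w) : ∃ K : ℤ, 0 ≤ K ∧ ∀ f : V → ℤ,
      |f w - f v| ≤ K * ∑ e ∈ A, |f (ends e).2 - f (ends e).1| := by
  induction h with
  | refl => exact ⟨0, le_rfl, fun f => by simp⟩
  | @tail b c _ hbc ih =>
    obtain ⟨K, hK, ih⟩ := ih
    obtain ⟨e, he, hbc⟩ := hbc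
    refine ⟨K + 1, by omega, fun f => ?_⟩
    have h1 : |f c - f b| ≤ ∑ e ∈ A, |f (ends e).2 - f (ends e).1| := by
      have h2 : |f c - f b| = |f (ends e).2 - f (ends e).1| := by
        simp only [eSym, Sym2.eq_iff] at hbc
        rcases hbc with ⟨h3, h4⟩ | ⟨h3, h4⟩
        · rw [h3, h4]
        · rw [h3, h4, abs_sub_comm]
      rw [h2]
      exact Finset.single_le_sum (f := fun e => |f (ends e).2 - f (ends e).1|)
        (fun _ _ => abs_nonneg _) he
    have h3 := abs_sub_le (f c) (f b) (f v)
    have h4 := ih f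
    linarith

omit [Fintype E] [DecidableEq V] [DecidableEq E] in
lemma Conn.exists_abs_sub_le {ends : E → V × V} {A : Finset E} (hA : Conn ends A) (q : V) :
    ∃ K : ℤ, 0 ≤ K ∧ ∀ (f : V → ℤ) (v : V),
      |f v - f q| ≤ K * ∑ e ∈ A, |f (ends e).2 - f (ends e).1| := by
  choose K hK hle using fun v => (hA.2 q v).exists_abs_sub_le
  refine ⟨∑ v, K v, Finset.sum_nonneg fun v _ => hK v, fun f v => (hle v f).trans ?_⟩
  exact mul_le_mul_of_nonneg_right
    (Finset.single_le_sum (fun v _ => hK v) (Finset.mem_univ v))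
    (Finset.sum_nonneg fun _ _ => abs_nonneg _)

/-- A quadratic energy on integral potentials. -/
def energy (ends : E → V × V) (A : Finset E) (n : ℤ) (c f : V → ℤ) : ℤ :=
  n * ∑ e ∈ A, ((f (ends e).2 - f (ends e).1) ^ 2 + f (ends e).1 + f (ends e).2) - ∑ v, c v * f v

omit [Fintype E] [DecidableEq V] [DecidableEq E] in
lemma exists_forall_energy_ge {ends : E → V × V} {A : Finset E} (hA : Conn ends A) {n : ℤ}
    (hn : 1 ≤ n) {c : V → ℤ} (hc : ∑ v, c v = 2 * n * A.card) :
    ∃ f, ∀ g, energy ends A n c f ≤ energy ends A n c g := by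
  obtain ⟨q⟩ := hA.1
  obtain ⟨K, hK, hle⟩ := hA.exists_abs_sub_le q
  set M : ℤ := (2 * n * A.card + ∑ v, |c v|) * K with hM
  have hbdd : ∀ f, -(A.card * M ^ 2) ≤ energy ends A n c f := by
    intro f
    set S : ℤ := ∑ e ∈ A, |f (ends e).2 - f (ends e).1| with hS
    have h1 : energy ends A n c f =
        n * ∑ e ∈ A, (f (ends e).2 - f (ends e).1) ^ 2 +
        n * ∑ e ∈ A, ((f (ends e).1 - f q) + (f (ends e).2 - f q)) -
        ∑ v, c v * (f v - f q) := by
      simp only [energy, mul_sub, Finset.sum_sub_distrib, Finset.sum_add_distrib,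
        ← Finset.sum_mul, hc, Finset.sum_const, nsmul_eq_mul]
      ring
    have h2 : -(2 * A.card * (K * S)) ≤
        ∑ e ∈ A, ((f (ends e).1 - f q) + (f (ends e).2 - f q)) := by
      have : ∑ _e ∈ A, -(2 * (K * S)) ≤
          ∑ e ∈ A, ((f (ends e).1 - f q) + (f (ends e).2 - f q)) := by
        refine Finset.sum_le_sum fun e _ => ?_
        have h3 := neg_le_of_abs_le (hle f (ends e).1)
        have h4 := neg_le_of_abs_le (hle f (ends e).2)
        linarith
      rw [Finset.sum_const, nsmul_eq_mul] at this
      linarith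
    have h3 : ∑ v, c v * (f v - f q) ≤ (∑ v, |c v|) * (K * S) := by
      rw [Finset.sum_mul]
      refine Finset.sum_le_sum fun v _ => (le_abs_self _).trans ?_
      rw [abs_mul]
      exact mul_le_mul_of_nonneg_left (hle f v) (abs_nonneg _)
    have h4 : -(A.card * M ^ 2) ≤
        n * ∑ e ∈ A, (f (ends e).2 - f (ends e).1) ^ 2 - M * S := by
      have : ∑ _e ∈ A, -(M ^ 2) ≤ ∑ e ∈ A, (n * (f (ends e).2 - f (ends e).1) ^ 2 -
          M * |f (ends e).2 - f (ends e).1|) := by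
        refine Finset.sum_le_sum fun e _ => ?_
        rw [← sq_abs (f (ends e).2 - f (ends e).1)]
        nlinarith [sq_nonneg (2 * |f (ends e).2 - f (ends e).1| - M), sq_nonneg M,
          mul_nonneg (sub_nonneg.2 hn) (sq_nonneg |f (ends e).2 - f (ends e).1|)]
      rw [Finset.sum_const, nsmul_eq_mul, Finset.sum_sub_distrib, ← Finset.mul_sum,
        ← Finset.mul_sum] at this
      linarith
    have h5 := mul_le_mul_of_nonneg_left h2 (by omega : 0 ≤ n)
    have h6 : M * S = n * (2 * A.card * (K * S)) + (∑ v, |c v|) * (K * S) := by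
      rw [hM]
      ring
    rw [h1]
    linarith
  obtain ⟨_, ⟨f, rfl⟩, hf⟩ := Int.exists_least_of_bdd (P := fun z => ∃ f, energy ends A n c f = z)
    ⟨_, fun z ⟨f, hf⟩ => hf ▸ hbdd f⟩ ⟨_, 0, rfl⟩
  exact ⟨f, fun g => hf _ ⟨g, rfl⟩⟩

omit [Fintype E] [DecidableEq E] in
lemma energy_sub_indicator (ends : E → V × V) (A : Finset E) (n : ℤ) (c f : V → ℤ)
    (W : Finset V) :
    energy ends A n c (fun v => f v - if v ∈ W then 1 else 0) = energy ends A n c f +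
      2 * n * (∑ v ∈ W, laplacian ends A f v - (innerEdges ends A W).card) + ∑ v ∈ W, c v := by
  have h1 : ∑ v, c v * (f v - if v ∈ W then 1 else 0) = ∑ v, c v * f v - ∑ v ∈ W, c v := by
    simp [mul_sub, Finset.sum_sub_distrib]
  rw [sum_laplacian, energy, h1, energy, innerEdges, Finset.card_filter, Nat.cast_sum,
    ← Finset.sum_sub_distrib]
  have h2 : ∀ e ∈ A, (((f (ends e).2 - if (ends e).2 ∈ W then 1 else 0) -
      (f (ends e).1 - if (ends e).1 ∈ W then 1 else 0)) ^ 2 +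
      (f (ends e).1 - if (ends e).1 ∈ W then 1 else 0) +
      (f (ends e).2 - if (ends e).2 ∈ W then 1 else 0)) =
      ((f (ends e).2 - f (ends e).1) ^ 2 + f (ends e).1 + f (ends e).2) +
      2 * (((if (ends e).1 ∈ W then 1 else 0) - if (ends e).2 ∈ W then 1 else 0) *
        (f (ends e).2 - f (ends e).1) -
        ((if (ends e).1 ∈ W ∧ (ends e).2 ∈ W then 1 else 0 : ℕ) : ℤ)) := by
    intro e _
    by_cases ha : (ends e).1 ∈ W <;> by_cases hb : (ends e).2 ∈ W <;> simp [ha, hb] <;> ring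
  rw [Finset.sum_congr rfl h2, Finset.sum_add_distrib, ← Finset.mul_sum]
  ring

omit [Fintype E] [DecidableEq E] in
lemma exists_isBalanced {ends : E → V × V} {A : Finset E} (hA : Conn ends A) {x : V → ℤ}
    (hx : ∑ v, x v = A.card - Fintype.card V + 1) :
    ∃ y, IsBalanced ends A y ∧ x - y ∈ twGroup ends A := by
  have := hA.1
  have hn : (1 : ℤ) ≤ Fintype.card V := by exact_mod_cast Fintype.card_pos
  set n : ℤ := (Fintype.card V : ℤ) with hn_def
  have hc : ∀ W : Finset V, ∑ v ∈ W, (n * (2 * x v + 2) - 2) =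
      n * (2 * ∑ v ∈ W, x v + 2 * W.card) - 2 * W.card := by
    intro W
    simp only [Finset.sum_sub_distrib, ← Finset.mul_sum, Finset.sum_add_distrib,
      Finset.sum_const, nsmul_eq_mul]
    ring
  obtain ⟨f, hf⟩ := exists_forall_energy_ge hA hn (c := fun v => n * (2 * x v + 2) - 2) (by
    rw [hc, hx, Finset.card_univ, ← hn_def]
    ring)
  refine ⟨x + laplacian ends A f, ⟨?_, fun W hW => ?_⟩, mem_twGroup_iff.2 ⟨-f, by simp⟩⟩
  · simp only [Pi.add_apply, Finset.sum_add_distrib]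
    rw [sum_laplacian, hx]
    simp [n]
  · have h1 := hf fun v => f v - if v ∈ W then 1 else 0
    rw [energy_sub_indicator, hc] at h1
    simp only [Pi.add_apply, Finset.sum_add_distrib]
    have hWpos : (0 : ℤ) < W.card := by exact_mod_cast hW.card_pos
    have h2 : 0 < n * (∑ v ∈ W, x v + ∑ v ∈ W, laplacian ends A f v -
        (innerEdges ends A W).card + W.card) := by linarith
    have h3 := pos_of_mul_pos_right h2 (by omega)
    omega

/-- For a connected multigraph `Γ` with genus function `gen`, the
assignment `σ_IBD` of integral break divisors is a degree-`g(Γ)` stability assignment,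
where `g(Γ) = b₁(Γ) + Σ_v gen v = |E| − |V| + 1 + Σ_v gen v`. -/
theorem statement11 (ends : E → V × V) (gen : V → ℕ)
    (hconn : Conn ends (Finset.univ : Finset E)) :
    IsStabilityAssignment ends
      ((Fintype.card E : ℤ) - (Fintype.card V : ℤ) + 1 + ∑ v : V, (gen v : ℤ))
      (fun A : Finset E => {x : V → ℤ | isIBD ends gen A x}) := by
  have hcompl : ∀ A : Finset E, ((Finset.univ \ A).card : ℤ) = Fintype.card E - A.card := by
    intro A
    have := Finset.card_sdiff_add_card_eq_card (Finset.subset_univ A)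
    rw [Finset.card_univ] at this
    omega
  have := hconn.1
  have hdeg : ∀ (A : Finset E) (x : V → ℤ),
      x ∈ Sdeg ((Fintype.card E : ℤ) - (Fintype.card V : ℤ) + 1 + ∑ v : V, (gen v : ℤ)) A ↔
        ∑ v, (x v - gen v) = A.card - Fintype.card V + 1 := by
    intro A x
    rw [Sdeg, Set.mem_ofPred_eq, nG, hcompl, Finset.sum_sub_distrib]
    omega
  refine ⟨fun A x hx => ⟨?_, (hdeg A x).2 (isIBD_iff.1 hx).1⟩, ?_, fun A hA =>
    ⟨fun x hx => (hdeg A x).2 (isIBD_iff.1 hx).1, fun x hx => ?_⟩⟩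
  · obtain ⟨T, hTA, hT, -⟩ := hx
    exact ⟨hT.1.1, fun v w => (hT.1.2 v w).mono hTA⟩
  · rintro A x ⟨T, hTA, hT, t, ht, rfl⟩ e he v hv
    have heT : e ∉ T := fun h => he (hTA h)
    have hupd : ∀ e' ∈ A \ T, Function.update t e v e' = t e' := fun e' he' =>
      Function.update_of_ne (by rintro rfl; exact he (Finset.mem_sdiff.1 he').1) _ _
    refine ⟨T, hTA.trans (Finset.subset_insert _ _), hT, Function.update t e v, ?_, ?_⟩
    · rw [Finset.insert_sdiff_of_notMem _ heT]
      intro e' he'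
      rcases Finset.mem_insert.1 he' with rfl | he'
      · rwa [Function.update_self]
      · rw [hupd e' he']
        exact ht e' he'
    · ext w
      rw [Finset.insert_sdiff_of_notMem _ heT, Finset.filter_insert, Function.update_self,
        Finset.filter_congr fun e' he' => by rw [hupd e' he']]
      simp only [Pi.add_apply, stdVec]
      by_cases hw : v = w
      · rw [if_pos hw, if_pos hw.symm, Finset.card_insert_of_notMem (by simp [he])]
        push_cast
        ring
      · rw [if_neg hw, if_neg (Ne.symm hw), add_zero]
  · obtain ⟨y, hy, hxy⟩ := exists_isBalanced hA ((hdeg A x).1 hx)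
    refine ⟨fun v => y v + gen v, ⟨isIBD_iff.2 (by simpa using hy), ?_⟩, ?_⟩
    · convert hxy using 1
      ext v
      simp only [Pi.sub_apply]
      ring
    · rintro z ⟨hz, hxz⟩
      have h : (fun v => z v - gen v : V → ℤ) - y ∈ twGroup ends A := by
        convert sub_mem hxy hxz using 1
        ext v
        simp only [Pi.sub_apply]
        ring
      have h2 := (isIBD_iff.1 hz).eq_of_sub_mem hy h
      ext v
      have := congrFun h2 v
      linarith
end

section
/- Let Γ be a finite multigraph and let Γ̃ be the subdivision of Γ in which each edge is subdivided once (one exceptional vertex inserted in the middle of each edge). For x ∈ ℤ^{Verts(Γ)} write x̃ ∈ ℤ^{Verts(Γ̃)} for the extension of x by zero on all exceptional vertices. Suppose x, y ∈ ℤ^{Verts(Γ)} and f : Verts(Γ) → ℤ satisfy x − y = Σ_{v ∈ Verts(Γ)} f(v)·tw_{Γ,v}. Define g : Verts(Γ̃) → ℤ by g(v) = 2f(v') when v is the vertex of Γ̃ corresponding to v' ∈ Verts(Γ), and g(v) = f(w) + f(w') when v is the exceptional vertex on the edge of Γ joining w and w' (so g(v) = 2f(w) for a loop at w). Then x̃ −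 ỹ = Σ_{v ∈ Verts(Γ̃)} g(v)·tw_{Γ̃,v}. In particular, if x − y ∈ tw(Γ) then x̃ − ỹ ∈ tw(Γ̃). -/
open Finset

variable {V E : Type} [Fintype V] [Fintype E] [DecidableEq V] [DecidableEq E]

/-- Each entry of a twister is a sum of contributions of the individual edges. -/
theorem twVec_apply {W F : Type} [DecidableEq W] (ends : F → W × W) (A : Finset F) (v w : W) :
    twVec ends A v w = ∑ e ∈ A,
      ((if w = (ends e).1 then
          (if v = (ends e).2 then (1 : ℤ) else 0) - (if v = (ends e).1 then 1 else 0) else 0) +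
        (if w = (ends e).2 then
          (if v = (ends e).1 then (1 : ℤ) else 0) - (if v = (ends e).2 then 1 else 0) else 0)) := by
  unfold twVec
  split_ifs with h
  · subst h
    rw [Finset.card_filter, Nat.cast_sum, ← Finset.sum_neg_distrib]
    refine Finset.sum_congr rfl fun e _ => ?_
    simp only [eSym, Sym2.mem_iff, Sym2.mk_isDiag_iff]
    grind
  · rw [Finset.card_filter, Nat.cast_sum]
    refine Finset.sum_congr rfl fun e _ => ?_
    simp only [eSym, Sym2.eq_iff]
    grind

/-- The combination of twisters with coefficients `g` is the sum over the edges of the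
differences of `g` along them. -/
theorem sum_smul_twVec_apply {W F : Type} [Fintype W] [DecidableEq W] (ends : F → W × W)
    (A : Finset F) (g : W → ℤ) (w : W) :
    (∑ v, g v • twVec ends A v) w = ∑ e ∈ A,
      ((if w = (ends e).1 then g (ends e).2 - g (ends e).1 else 0) +
        (if w = (ends e).2 then g (ends e).1 - g (ends e).2 else 0)) := by
  simp only [Finset.sum_apply, Pi.smul_apply, twVec_apply, smul_eq_mul, Finset.mul_sum]
  rw [Finset.sum_comm]
  refine Finset.sum_congr rfl fun e _ => ?_
  split_ifs <;>
    simp only [mul_add, mul_sub, mul_ite, mul_one, mul_zero,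
      Finset.sum_add_distrib, Finset.sum_sub_distrib, Finset.sum_ite_eq', Finset.mem_univ,
      Finset.sum_const_zero, if_true]

/-- An integer combination of twisters lies in the twister group. -/
theorem sum_smul_twVec_mem_twGroup {W F : Type} [Fintype W] [DecidableEq W] (ends : F → W × W)
    (A : Finset F) (g : W → ℤ) :
    ∑ v, g v • twVec ends A v ∈ twGroup ends A :=
  AddSubgroup.sum_mem _ fun v _ =>
    AddSubgroup.zsmul_mem _ (AddSubgroup.subset_closure (Set.mem_range_self v)) _

/-- Let `Γ̃` be the subdivision of `Γ` with each edge subdivided once.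
If `x − y = Σ_v f(v)·tw_{Γ,v}`, then for the lift `g` (`g = 2f` on original vertices and
`g = f(w) + f(w')` on the exceptional vertex of the edge joining `w` and `w'`) one has
`x̃ − ỹ = Σ_w g(w)·tw_{Γ̃,w}`; in particular `x̃ − ỹ ∈ tw(Γ̃)`. -/
theorem statement13 (ends : E → V × V) (x y : V → ℤ) (f : V → ℤ)
    (hf : x - y = ∑ v : V, f v • twVec ends (Finset.univ : Finset E) v) :
    ((Sum.elim x fun _ => 0) - (Sum.elim y fun _ => 0) : SubV V E (fun _ => 1) → ℤ) =
        (∑ w : SubV V E (fun _ => 1),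
          (Sum.elim (fun v => 2 * f v) (fun p => f (ends p.1).1 + f (ends p.1).2) w) •
            twVec (subEnds ends fun _ => 1)
              (Finset.univ : Finset (SubE E fun _ => 1)) w) ∧
      ((Sum.elim x fun _ => 0) - (Sum.elim y fun _ => 0) : SubV V E (fun _ => 1) → ℤ) ∈
        twGroup (subEnds ends fun _ => 1) (Finset.univ : Finset (SubE E fun _ => 1)) := by
  have key : ((Sum.elim x fun _ => 0) - (Sum.elim y fun _ => 0) : SubV V E (fun _ => 1) → ℤ) =
      ∑ w : SubV V E (fun _ => 1),
        (Sum.elim (fun v => 2 * f v) (fun p => f (ends p.1).1 + f (ends p.1).2) w) •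
          twVec (subEnds ends fun _ => 1) (Finset.univ : Finset (SubE E fun _ => 1)) w := by
    funext w
    rw [sum_smul_twVec_apply, Fintype.sum_sigma]
    rcases w with u | ⟨e, i⟩
    · have hu := congrFun hf u
      rw [sum_smul_twVec_apply] at hu
      simp only [Pi.sub_apply, Sum.elim_inl] at hu ⊢
      rw [hu]
      refine Finset.sum_congr rfl fun e _ => ?_
      simp [subEnds, subNode, Fin.sum_univ_two]
      grind
    · obtain rfl : i = 0 := Subsingleton.elim _ _
      rw [Finset.sum_eq_single e]
      · simp [subEnds, subNode, Fin.sum_univ_two]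
        ring
      · intro b _ hb
        simp [subEnds, subNode, Fin.sum_univ_two, hb.symm]
      · simp
  exact ⟨key, key ▸ sum_smul_twVec_mem_twGroup _ _ _⟩
end

section
/- Let g ≥ 2 and d ∈ ℤ. Let GSym_g be the trivalent multigraph with vertices v₁, …, v_{2g−2} (indices modulo 2g−2), cycle edges e_i joining v_i and v_{i+1} for each i, and diameter edges e'_j joining v_j and v_{j+g−1} for j = 1, …, g−1, and let Γ_g be the spanning subgraph of GSym_g consisting of the cycle edges. If σ and τ are degree-d stability assignments for GSym_g such that the sets σ(Γ_g) and τ(Γ_g) are both invariant under the rotation permutation ρ : v_i ↦ v_{i+1} (acting on ℤ^{Verts(GSym_g)} by permuting coordinates), then σ(Γ_g) = τ(Γ_g). Moreover, if at least one such σ exists, then gcd(d − g + 1, 2g − 2) = 1. -/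
open Finset

variable {V E : Type} [Fintype V] [Fintype E] [DecidableEq V] [DecidableEq E]

/-- The trivalent graph `GSym_g` for `g = n + 2`: vertices `ZMod (2g−2)`, cycle edges
`e_i = {v_i, v_{i+1}}` and diameter edges `e'_j = {v_j, v_{j+g−1}}`, `j = 1, …, g−1`. -/
def gsymEnds (n : ℕ) :
    (ZMod (2 * n + 1 + 1) ⊕ Fin (n + 1)) → ZMod (2 * n + 1 + 1) × ZMod (2 * n + 1 + 1) :=
  Sum.elim (fun i => (i, i + 1))
    (fun j => ((((j : ℕ) + 1 : ℕ) : ZMod (2 * n + 1 + 1)),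
      (((j : ℕ) + 1 + (n + 1) : ℕ) : ZMod (2 * n + 1 + 1))))

/-- The spanning subgraph `Γ_g ⊆ GSym_g` consisting of the cycle edges. -/
def cycleEdges (n : ℕ) : Finset (ZMod (2 * n + 1 + 1) ⊕ Fin (n + 1)) :=
  Finset.univ.filter fun e => e.isLeft

section CyclicConfigurations

variable {N : ℕ} [NeZero N]

/-- The weighted sum `∑ v, x(v) · v` modulo `N`, which detects the chip-firing class of a
multidegree on the `N`-cycle. -/
def weightedSum (x : ZMod N → ℤ) : ZMod N := ∑ v, (x v : ZMod N) * v

lemma weightedSum_sub (x y : ZMod N → ℤ) :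
    weightedSum (x - y) = weightedSum x - weightedSum y := by
  simp [weightedSum, sub_mul, Finset.sum_sub_distrib]

lemma weightedSum_add (x y : ZMod N → ℤ) :
    weightedSum (x + y) = weightedSum x + weightedSum y := by
  simp [weightedSum, add_mul, Finset.sum_add_distrib]

lemma weightedSum_stdVec (v : ZMod N) : weightedSum (stdVec v) = v := by
  simp [weightedSum, stdVec]

lemma weightedSum_shift (x : ZMod N → ℤ) (m : ZMod N) :
    weightedSum (fun w => x (w + m)) = weightedSum x - m * ((∑ v, x v : ℤ) : ZMod N) := by
  have h : weightedSum (fun w => x (w + m)) = ∑ v, (x v : ZMod N) * (v - m) :=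
    Fintype.sum_equiv (Equiv.addRight m) _ _ (by simp)
  rw [h]
  simp only [weightedSum, mul_sub, Finset.sum_sub_distrib]
  push_cast
  rw [Finset.mul_sum]
  simp [mul_comm]

lemma shift_mem {S : Set (ZMod N → ℤ)} (hrot : ∀ x ∈ S, (fun w => x (w + 1)) ∈ S)
    {x : ZMod N → ℤ} (hx : x ∈ S) (m : ZMod N) : (fun w => x (w + m)) ∈ S := by
  have h : ∀ k : ℕ, (fun w => x (w + (k : ZMod N))) ∈ S := by
    intro k
    induction k with
    | zero => simpa using hx
    | succ k ih =>
      convert hrot _ ih using 3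
      push_cast
      ring
  simpa using h m.val

lemma eq_const_of_periodic {f : ZMod N → ℤ} {k : ZMod N} (hk : IsUnit k)
    (hf : ∀ w, f (w + k) = f w) (w : ZMod N) : f w = f 0 := by
  have h : ∀ m : ℕ, f (m * k) = f 0 := by
    intro m
    induction m with
    | zero => simp
    | succ m ih => rw [← ih, ← hf (m * k)]; push_cast; ring_nf
  obtain ⟨u, rfl⟩ := hk
  have := h (w * ↑u⁻¹ : ZMod N).val
  simpa [mul_assoc] using this

/-- The multidegrees of degree `D` in `S` are separated by their weighted sums, `S` is
rotation-invariant, and `S` contains `x + 𝐞₀` and `x + 𝐞₁` for some `x`. -/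
structure IsCyclicFamily (D : ℤ) (S : Set (ZMod N → ℤ)) : Prop where
  sum_eq : ∀ x ∈ S, ∑ v, x v = D
  eq_of_weightedSum_eq : ∀ x ∈ S, ∀ y ∈ S, weightedSum x = weightedSum y → x = y
  rot : ∀ x ∈ S, (fun w => x (w + 1)) ∈ S
  exists_adjacent : ∃ x : ZMod N → ℤ, x + stdVec 0 ∈ S ∧ x + stdVec 1 ∈ S

namespace IsCyclicFamily

variable {D : ℤ} {S T : Set (ZMod N → ℤ)}

lemma weightedSum_shift (hS : IsCyclicFamily D S) {x : ZMod N → ℤ} (hx : x ∈ S) (m : ZMod N) :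
    weightedSum (fun w => x (w + m)) = weightedSum x - m * (D : ZMod N) := by
  rw [_root_.weightedSum_shift, hS.sum_eq x hx]

lemma isUnit [Fact (1 < N)] (hS : IsCyclicFamily D S) : IsUnit (D : ZMod N) := by
  obtain ⟨x, h0, h1⟩ := hS.exists_adjacent
  have key : ∀ m : ZMod N, m * (D : ZMod N) = 0 → m = 0 := by
    intro m hm
    have per : ∀ y ∈ S, y m = y 0 := by
      intro y hy
      have := hS.eq_of_weightedSum_eq _ (shift_mem hS.rot hy m) _ hy
        (by rw [hS.weightedSum_shift hy, hm, sub_zero])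
      simpa using congrFun this 0
    have e0 := per _ h0
    have e1 := per _ h1
    by_contra hne
    simp only [Pi.add_apply, stdVec, if_neg hne, if_true, zero_ne_one, if_false] at e0 e1
    split_ifs at e1 <;> omega
  have hinj : Function.Injective (fun m : ZMod N => m * (D : ZMod N)) := by
    intro a b hab
    exact sub_eq_zero.1 (key _ (by rw [sub_mul]; exact sub_eq_zero.2 hab))
  obtain ⟨m, hm⟩ := Finite.surjective_of_injective hinj 1
  exact IsUnit.of_mul_eq_one m (by rw [mul_comm]; exact hm)

/-- With `k · D = -1`, the rotation by `k` moves a chip from `0` to `1`. -/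
lemma shift_adjacent (hS : IsCyclicFamily D S) {k : ZMod N} (hk : k * (D : ZMod N) = -1)
    {x : ZMod N → ℤ} (h0 : x + stdVec 0 ∈ S) (h1 : x + stdVec 1 ∈ S) (w : ZMod N) :
    (x + stdVec 0 : ZMod N → ℤ) (w + k) = (x + stdVec 1 : ZMod N → ℤ) w := by
  refine congrFun (hS.eq_of_weightedSum_eq _ (shift_mem hS.rot h0 k) _ h1 ?_) w
  rw [hS.weightedSum_shift h0, hk, weightedSum_add, weightedSum_add, weightedSum_stdVec,
    weightedSum_stdVec]
  ring

lemma exists_mem_inter [Fact (1 < N)] (hS : IsCyclicFamily D S) (hT : IsCyclicFamily D T) :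
    ∃ y, y ∈ S ∧ y ∈ T := by
  obtain ⟨u, hu⟩ := hS.isUnit
  have hk : ((-u⁻¹ : (ZMod N)ˣ) : ZMod N) * (D : ZMod N) = -1 := by
    rw [← hu]; simp
  obtain ⟨x, hx0, hx1⟩ := hS.exists_adjacent
  obtain ⟨z, hz0, hz1⟩ := hT.exists_adjacent
  have hconst := eq_const_of_periodic (f := x - z) (-u⁻¹).isUnit (fun w => by
    have e1 := hS.shift_adjacent hk hx0 hx1 w
    have e2 := hT.shift_adjacent hk hz0 hz1 w
    simp only [Pi.add_apply, Pi.sub_apply] at e1 e2 ⊢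
    linarith)
  have hsum : ∑ v, (x - z) v = 0 := by
    have e1 := hS.sum_eq _ hx0
    have e2 := hT.sum_eq _ hz0
    simp only [Pi.add_apply, Pi.sub_apply, Finset.sum_add_distrib,
      Finset.sum_sub_distrib] at e1 e2 ⊢
    linarith
  rw [Finset.sum_congr rfl (fun v _ => hconst v)] at hsum
  have hzero : (x - z) 0 = 0 := by
    rw [Finset.sum_const, Finset.card_univ, ZMod.card] at hsum
    exact (smul_eq_zero.1 hsum).resolve_left (NeZero.ne N)
  have hxz : x = z := by
    funext v
    have := hconst v
    rw [hzero, Pi.sub_apply] at this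
    linarith
  exact ⟨x + stdVec 0, hx0, hxz ▸ hz0⟩

lemma subset [Fact (1 < N)] (hS : IsCyclicFamily D S) (hT : IsCyclicFamily D T) : S ⊆ T := by
  obtain ⟨y, hyS, hyT⟩ := hS.exists_mem_inter hT
  obtain ⟨u, hu⟩ := hS.isUnit
  intro x hx
  have h := hS.eq_of_weightedSum_eq _ hx _
    (shift_mem hS.rot hyS ((weightedSum y - weightedSum x) * ↑u⁻¹)) (by
      rw [hS.weightedSum_shift hyS, ← hu, mul_assoc, Units.inv_mul]; ring)
  rw [h]
  exact shift_mem hT.rot hyT _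

end IsCyclicFamily

/-- A homomorphism that kills all second differences of the standard basis of `ℤ^(ℤ/N)` kills
every vector of sum zero and weighted sum zero. -/
lemma map_eq_zero_of_weightedSum_eq_zero {M : Type*} [AddCommGroup M] (q : (ZMod N → ℤ) →+ M)
    (hq : ∀ v : ZMod N, q (stdVec (v + 1 + 1) + stdVec v - 2 • stdVec (v + 1)) = 0)
    {x : ZMod N → ℤ} (hsum : ∑ v, x v = 0) (hx : weightedSum x = 0) : q x = 0 := by
  let a : ZMod N → M := fun v => q (stdVec v)
  have hstep : ∀ v, a (v + 1 + 1) + a v - 2 • a (v + 1) = 0 := by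
    intro v
    rw [← hq v, map_sub, map_add, map_nsmul]
  set δ := a 1 - a 0 with hδ
  have hdiff : ∀ k : ℕ, a (k + 1 : ZMod N) - a (k : ZMod N) = δ := by
    intro k
    induction k with
    | zero => simp [hδ]
    | succ k ih =>
      have := hstep k
      rw [← ih, ← sub_eq_zero, ← this]
      push_cast
      abel
  have hlin : ∀ k : ℕ, a (k : ZMod N) = a 0 + (k : ℤ) • δ := by
    intro k
    induction k with
    | zero => simp
    | succ k ih =>
      have h := hdiff k
      rw [sub_eq_iff_eq_add] at h
      push_cast
      rw [h, ih, add_smul, one_smul]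
      abel
  have hN : (N : ℤ) • δ = 0 := by
    have := hlin N
    simpa using this
  have hxs : x = ∑ v, x v • (stdVec v : ZMod N → ℤ) := by
    funext w
    simp [stdVec]
  have hqx : q x = ∑ v, x v • a v := by
    conv_lhs => rw [hxs]
    simp only [map_sum, map_zsmul, a]
  have hval : ∀ v : ZMod N, a v = a 0 + (v.val : ℤ) • δ := by
    intro v
    simpa using hlin v.val
  have hdvd : (N : ℤ) ∣ ∑ v : ZMod N, x v * (v.val : ℤ) := by
    rw [← ZMod.intCast_zmod_eq_zero_iff_dvd]
    simpa [weightedSum] using hx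
  obtain ⟨c, hc⟩ := hdvd
  have hterm : ∀ v, x v • a v = x v • a 0 + (x v * (v.val : ℤ)) • δ := by
    intro v
    rw [hval v, smul_add, smul_smul]
  rw [hqx, Finset.sum_congr rfl fun v _ => hterm v]
  rw [Finset.sum_add_distrib, ← Finset.sum_smul, ← Finset.sum_smul, hsum, hc, mul_comm, mul_smul,
    hN]
  simp

end CyclicConfigurations

section CycleOfGSym

variable (n : ℕ)

lemma eSym_gsymEnds_inl (i : ZMod (2 * n + 1 + 1)) : eSym (gsymEnds n) (Sum.inl i) = s(i, i + 1) :=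
  rfl

lemma inl_mem_cycleEdges (i : ZMod (2 * n + 1 + 1)) : Sum.inl i ∈ cycleEdges n := by
  simp [cycleEdges]

lemma cycleEdges_eq_map : cycleEdges n = Finset.univ.map Function.Embedding.inl := by
  ext (i | j) <;> simp [cycleEdges]

lemma nG_cycleEdges : nG (cycleEdges n) = n + 1 := by
  rw [nG, Finset.card_sdiff_of_subset (Finset.subset_univ _), cycleEdges_eq_map]
  simp

lemma twVec_cycleEdges (v : ZMod (2 * n + 1 + 1)) :
    twVec (gsymEnds n) (cycleEdges n) (v + 1) =
      stdVec (v + 1 + 1) + stdVec v - 2 • stdVec (v + 1) := by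
  have : Fact (1 < 2 * n + 1 + 1) := ⟨by omega⟩
  have hne : ∀ i : ZMod (2 * n + 1 + 1), i ≠ i + 1 := by simp
  funext w
  rw [cycleEdges_eq_map]
  simp only [twVec, Finset.filter_map, Finset.card_map, Function.comp_def,
    Function.Embedding.inl_apply, eSym_gsymEnds_inl, Sym2.mk_isDiag_iff, hne, not_false_eq_true,
    and_true, Sym2.mem_iff]
  by_cases hw : w = v + 1
  · subst hw
    have hf : (Finset.univ.filter fun i : ZMod (2 * n + 1 + 1) => v + 1 = i ∨ v + 1 = i + 1) =
        {v + 1, v} := by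
      ext i
      simp [eq_comm]
    rw [hf, Finset.card_pair (hne v).symm]
    simp [stdVec]
  · have hf : ((Finset.univ.filter fun i : ZMod (2 * n + 1 + 1) => s(i, i + 1) = s(v + 1, w)).card
        : ℤ) = ∑ i, ((if i = v + 1 then (if w = v + 1 + 1 then 1 else 0) else 0) +
          (if i = v then (if w = v then 1 else 0) else 0)) := by
      rw [Finset.card_filter]
      push_cast
      refine Finset.sum_congr rfl fun i _ => ?_
      simp only [Sym2.eq_iff]
      by_cases h1 : i = v + 1
      · subst h1
        simp [eq_comm]
      · by_cases h2 : i = v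
        · subst h2
          simp [eq_comm]
        · simp [h1, h2]
    rw [if_neg hw, hf, Finset.sum_add_distrib]
    simp [stdVec, hw]

lemma conn_cycleEdges_erase : Conn (gsymEnds n) ((cycleEdges n).erase (Sum.inl 0)) := by
  refine ⟨⟨0⟩, ?_⟩
  have hsymm : Std.Symm fun v w => ∃ e ∈ (cycleEdges n).erase (Sum.inl 0),
      eSym (gsymEnds n) e = s(v, w) :=
    ⟨fun v w ⟨e, he, h⟩ => ⟨e, he, h.trans Sym2.eq_swap⟩⟩
  have hpath : ∀ j : ℕ, j < 2 * n + 1 + 1 →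
      Linked (gsymEnds n) ((cycleEdges n).erase (Sum.inl 0)) 1 (1 + j) := by
    intro j
    induction j with
    | zero => intro _; rw [Nat.cast_zero, add_zero]; exact Relation.ReflTransGen.refl
    | succ j ih =>
      intro hj
      refine (ih (by omega)).tail ⟨Sum.inl (1 + j), ?_, ?_⟩
      · refine Finset.mem_erase.2 ⟨fun h => ?_, inl_mem_cycleEdges n _⟩
        have h' : ((1 + j : ℕ) : ZMod (2 * n + 1 + 1)) = 0 := by
          simpa using Sum.inl_injective h
        rw [ZMod.natCast_eq_zero_iff] at h'
        exact absurd (Nat.le_of_dvd (by omega) h') (by omega)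
      · rw [eSym_gsymEnds_inl]
        rw [Nat.cast_succ, add_assoc (1 : ZMod (2 * n + 1 + 1))]
  have hall : ∀ w, Linked (gsymEnds n) ((cycleEdges n).erase (Sum.inl 0)) 1 w := by
    intro w
    simpa using hpath (w - 1).val (ZMod.val_lt _)
  exact fun v w => (Relation.ReflTransGen.stdSymm.symm _ _ (hall v)).trans (hall w)

lemma conn_cycleEdges : Conn (gsymEnds n) (cycleEdges n) :=
  ⟨⟨0⟩, fun v w => ((conn_cycleEdges_erase n).2 v w).lift id
    fun _ _ ⟨e, he, h⟩ => ⟨e, Finset.mem_of_mem_erase he, h⟩⟩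

variable {n}

lemma isCyclicFamily_cycleEdges {d : ℤ}
    {σ : Finset (ZMod (2 * n + 1 + 1) ⊕ Fin (n + 1)) → Set (ZMod (2 * n + 1 + 1) → ℤ)}
    (hσ : IsStabilityAssignment (gsymEnds n) d σ)
    (hrot : ∀ x ∈ σ (cycleEdges n), (fun w => x (w + 1)) ∈ σ (cycleEdges n)) :
    IsCyclicFamily (d - (n + 1 : ℕ)) (σ (cycleEdges n)) := by
  obtain ⟨-, hchip, hrep⟩ := hσ
  have hdeg : ∀ x ∈ σ (cycleEdges n), ∑ v, x v = d - (n + 1 : ℕ) := by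
    intro x hx
    have : x ∈ Sdeg d (cycleEdges n) := (hrep _ (conn_cycleEdges n)).1 hx
    simpa only [Sdeg, Set.mem_ofPred_eq, nG_cycleEdges] using this
  refine ⟨hdeg, ?_, hrot, ?_⟩
  · intro x hx y hy hxy
    obtain ⟨hsub, huniq⟩ := hrep _ (conn_cycleEdges n)
    refine (huniq x (hsub hx)).unique ⟨hx, by simp⟩ ⟨hy, ?_⟩
    refine (QuotientAddGroup.eq_zero_iff (x - y)).1
      (map_eq_zero_of_weightedSum_eq_zero (QuotientAddGroup.mk' _) (fun v => ?_) ?_ ?_)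
    · refine (QuotientAddGroup.eq_zero_iff _).2 ?_
      rw [← twVec_cycleEdges]
      exact AddSubgroup.subset_closure ⟨_, rfl⟩
    · simp [Finset.sum_sub_distrib, hdeg x hx, hdeg y hy]
    · rw [weightedSum_sub, hxy, sub_self]
  · set A := (cycleEdges n).erase (Sum.inl 0) with hA
    have hins : insert (Sum.inl 0) A = cycleEdges n :=
      Finset.insert_erase (inl_mem_cycleEdges n 0)
    obtain ⟨x, ⟨hx, -⟩, -⟩ := (hrep A (conn_cycleEdges_erase n)).2
      (fun w => if w = 0 then d - nG A else 0) (by simp [Sdeg])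
    have hadd := fun v hv => hchip A x hx (Sum.inl 0) (Finset.notMem_erase _ _) v hv
    rw [hins] at hadd
    exact ⟨x, hadd 0 (by simp [eSym_gsymEnds_inl]), hadd 1 (by simp [eSym_gsymEnds_inl])⟩

end CycleOfGSym

/-- (Here `g = n + 2 ≥ 2`.) If `σ` and `τ` are degree-`d` stability
assignments for `GSym_g` whose values on `Γ_g` are invariant under the rotation
`v_i ↦ v_{i+1}` (acting on `ℤ^{Verts}` by permuting coordinates), then
`σ(Γ_g) = τ(Γ_g)`; moreover, since such a `σ` exists, `gcd(d − g + 1, 2g − 2) = 1`. -/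
theorem statement16 (n : ℕ) (d : ℤ)
    (σ τ : Finset (ZMod (2 * n + 1 + 1) ⊕ Fin (n + 1)) → Set (ZMod (2 * n + 1 + 1) → ℤ))
    (hσ : IsStabilityAssignment (gsymEnds n) d σ)
    (hτ : IsStabilityAssignment (gsymEnds n) d τ)
    (hσrot : ∀ x ∈ σ (cycleEdges n), (fun w => x (w + 1)) ∈ σ (cycleEdges n))
    (hτrot : ∀ x ∈ τ (cycleEdges n), (fun w => x (w + 1)) ∈ τ (cycleEdges n)) :
    σ (cycleEdges n) = τ (cycleEdges n) ∧
      Int.gcd (d - ((n : ℤ) + 2) + 1) (2 * ((n : ℤ) + 2) - 2) = 1 := by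
  have : Fact (1 < 2 * n + 1 + 1) := ⟨by omega⟩
  have hS := isCyclicFamily_cycleEdges hσ hσrot
  have hT := isCyclicFamily_cycleEdges hτ hτrot
  refine ⟨(hS.subset hT).antisymm (hT.subset hS), ?_⟩
  have hcop := (ZMod.coe_int_isUnit_iff_isCoprime _ _).1 hS.isUnit
  rw [Int.isCoprime_iff_gcd_eq_one, Int.gcd_comm] at hcop
  rw [← hcop]
  congr 1 <;> push_cast <;> ring
end
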